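/- arXiv:2001.05117 — 2 statements merged into one kernel-verified Lean document; each statement's English description precedes it below -/
import Mathlib

section
/- (Core of Lemma 1) For every iteration l ≥ 0, every i ∈ ℤ with 0 ≤ i < L_1, and every j ∈ ℤ/L_2ℤ, the MD density-evolution values coincide with the 1D density-evolution values: x^{(l)}_{(i,j)} = x̄^{(l)}_i, and for l ≥ 1 also y^{(l)}_{(i,j)} = ȳ^{(l)}_i. -/
/-- Check-node DE map `Y(z)` for the MD-SC ensemble. -/
noncomputable def chkY (L₂ dr γ₁ γ₂ : ℕ) (T : ℝ) (z : ℤ × ZMod L₂ → ℝ)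
    (p : ℤ × ZMod L₂) : ℝ :=
  1 - (1 - ((1 - T) / (γ₁ : ℝ)) * ∑ k ∈ Finset.range γ₁, z (p.1 - (k : ℤ), p.2)
        - (T / ((γ₁ : ℝ) * ((γ₂ : ℝ) - 1))) *
            ∑ k ∈ Finset.range γ₁, ∑ r ∈ Finset.Icc 1 (γ₂ - 1),
              z (p.1 - (k : ℤ), p.2 - (r : ZMod L₂))) ^ (dr - 1)

/-- One-step DE update `F(z)` for the MD-SC ensemble. -/
noncomputable def updF (L₂ dl dr γ₁ γ₂ : ℕ) (T ε : ℝ) (z : ℤ × ZMod L₂ → ℝ)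
    (p : ℤ × ZMod L₂) : ℝ :=
  ε * (((1 - T) / (γ₁ : ℝ)) *
          ∑ k ∈ Finset.range γ₁, chkY L₂ dr γ₁ γ₂ T z (p.1 + (k : ℤ), p.2)
        + (T / ((γ₁ : ℝ) * ((γ₂ : ℝ) - 1))) *
            ∑ k ∈ Finset.range γ₁, ∑ r ∈ Finset.Icc 1 (γ₂ - 1),
              chkY L₂ dr γ₁ γ₂ T z (p.1 + (k : ℤ), p.2 + (r : ZMod L₂))) ^ (dl - 1)
/-- The MD density-evolution sequence `x^[l]`. -/
noncomputable def xMD (L₁ L₂ dl dr γ₁ γ₂ : ℕ) (T ε : ℝ) : ℕ → ℤ × ZMod L₂ → ℝ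
  | 0 => fun p => if 0 ≤ p.1 ∧ p.1 < (L₁ : ℤ) then 1 else 0
  | l + 1 => fun p =>
      if 0 ≤ p.1 ∧ p.1 < (L₁ : ℤ) then
        updF L₂ dl dr γ₁ γ₂ T ε (xMD L₁ L₂ dl dr γ₁ γ₂ T ε l) p
      else 0
/-- Check-node DE map for the 1D SC ensemble. -/
noncomputable def chkY1 (dr γ₁ : ℕ) (z : ℤ → ℝ) (i : ℤ) : ℝ :=
  1 - (1 - (1 / (γ₁ : ℝ)) * ∑ k ∈ Finset.range γ₁, z (i - (k : ℤ))) ^ (dr - 1)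

/-- The 1D density-evolution sequence `x̄^[l]`. -/
noncomputable def x1D (L₁ dl dr γ₁ : ℕ) (ε : ℝ) : ℕ → ℤ → ℝ
  | 0 => fun i => if 0 ≤ i ∧ i < (L₁ : ℤ) then 1 else 0
  | l + 1 => fun i =>
      if 0 ≤ i ∧ i < (L₁ : ℤ) then
        ε * ((1 / (γ₁ : ℝ)) *
            ∑ k ∈ Finset.range γ₁, chkY1 dr γ₁ (x1D L₁ dl dr γ₁ ε l) (i + (k : ℤ))) ^ (dl - 1)
      else 0

/-- Averaging a summand that does not depend on the auxiliary section merges the local and the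
multi-dimensional coupling weights into the uniform 1D weight. -/
theorem coupling_weights_merge {γ₁ γ₂ : ℕ} (hγ₂ : 2 ≤ γ₂) (T : ℝ) (f : ℕ → ℝ) :
    ((1 - T) / (γ₁ : ℝ)) * ∑ k ∈ Finset.range γ₁, f k
      + (T / ((γ₁ : ℝ) * ((γ₂ : ℝ) - 1))) *
          ∑ k ∈ Finset.range γ₁, ∑ _r ∈ Finset.Icc 1 (γ₂ - 1), f k
      = (1 / (γ₁ : ℝ)) * ∑ k ∈ Finset.range γ₁, f k := by
  have h2 : (2 : ℝ) ≤ γ₂ := by exact_mod_cast hγ₂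
  have h : ((γ₂ : ℝ) - 1) ≠ 0 := by linarith
  have hcast : ((γ₂ - 1 : ℕ) : ℝ) = (γ₂ : ℝ) - 1 := by
    rw [Nat.cast_sub (by omega), Nat.cast_one]
  simp only [Finset.sum_const, Nat.card_Icc, Nat.add_sub_cancel, nsmul_eq_mul, hcast,
    ← Finset.mul_sum]
  rcases eq_or_ne (γ₁ : ℝ) 0 with h1 | h1
  · simp [h1]
  · field_simp
    ring

theorem chkY_eq_chkY1 {L₂ dr γ₁ γ₂ : ℕ} (hγ₂ : 2 ≤ γ₂) (T : ℝ) {z : ℤ × ZMod L₂ → ℝ}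
    {w : ℤ → ℝ} (hz : ∀ i j, z (i, j) = w i) (i : ℤ) (j : ZMod L₂) :
    chkY L₂ dr γ₁ γ₂ T z (i, j) = chkY1 dr γ₁ w i := by
  simp only [chkY, chkY1, hz]
  rw [sub_sub (1 : ℝ), coupling_weights_merge hγ₂ T fun k => w (i - (k : ℤ))]

theorem xMD_eq_x1D {L₁ L₂ dl dr γ₁ γ₂ : ℕ} (hγ₂ : 2 ≤ γ₂) (T ε : ℝ) (l : ℕ) (i : ℤ)
    (j : ZMod L₂) :
    xMD L₁ L₂ dl dr γ₁ γ₂ T ε l (i, j) = x1D L₁ dl dr γ₁ ε l i := by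
  induction l generalizing i j with
  | zero => rfl
  | succ l ih =>
    simp only [xMD, x1D, updF, chkY_eq_chkY1 hγ₂ T ih]
    rw [coupling_weights_merge hγ₂ T
      fun k => chkY1 dr γ₁ (x1D L₁ dl dr γ₁ ε l) (i + (k : ℤ))]

/-- core of Lemma 1: for every iteration `l ≥ 0` and every section
`(i,j)` with `0 ≤ i < L₁`, the MD DE values coincide with the 1D DE values:
`x^[l]_{(i,j)} = x̄^[l]_i`, and (covering all `l ≥ 1`) the check-node values
`y^[l+1]_{(i,j)} = Y(x^[l])_{(i,j)}` equal `ȳ^[l+1]_i = Ȳ(x̄^[l])_i`. -/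
theorem stmt1 (dl dr L₁ L₂ γ₁ γ₂ : ℕ) (T ε : ℝ)
    (hdl : 2 ≤ dl) (hdr : 2 ≤ dr) (hL₁ : 1 ≤ L₁) (hL₂ : 2 ≤ L₂)
    (hγ₁ : 1 ≤ γ₁) (hγ₁L : γ₁ ≤ L₁) (hγ₂ : 2 ≤ γ₂) (hγ₂L : γ₂ ≤ L₂)
    (hT : T ∈ Set.Icc (0 : ℝ) 1) (hε : ε ∈ Set.Icc (0 : ℝ) 1) :
    ∀ (l : ℕ) (i : ℤ) (j : ZMod L₂), 0 ≤ i → i < (L₁ : ℤ) →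
      xMD L₁ L₂ dl dr γ₁ γ₂ T ε l (i, j) = x1D L₁ dl dr γ₁ ε l i ∧
      chkY L₂ dr γ₁ γ₂ T (xMD L₁ L₂ dl dr γ₁ γ₂ T ε l) (i, j)
        = chkY1 dr γ₁ (x1D L₁ dl dr γ₁ ε l) i := by
  intro l i j _ _
  exact ⟨xMD_eq_x1D hγ₂ T ε l i j, chkY_eq_chkY1 hγ₂ T (xMD_eq_x1D hγ₂ T ε l) i j⟩
end

section
/- The MD density-evolution sequence is entrywise nonincreasing in the iteration index: for every l ≥ 0 and every section (i,j) ∈ ℤ × (ℤ/L_2ℤ), x^{(l+1)}_{(i,j)} ≤ x^{(l)}_{(i,j)}; consequently, for every (i,j) the sequence l ↦ x^{(l)}_{(i,j)} converges to a limit in [0,1]. -/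
/-- The weighted average over coupled sections used by both maps. -/
noncomputable def couplingAvg (γ₁ γ₂ : ℕ) (T : ℝ) (f : ℕ → ℝ) (g : ℕ → ℕ → ℝ) : ℝ :=
  ((1 - T) / (γ₁ : ℝ)) * ∑ k ∈ Finset.range γ₁, f k
    + (T / ((γ₁ : ℝ) * ((γ₂ : ℝ) - 1))) *
        ∑ k ∈ Finset.range γ₁, ∑ r ∈ Finset.Icc 1 (γ₂ - 1), g k r

theorem couplingAvg_mono {γ₁ γ₂ : ℕ} {T : ℝ} (hγ₂ : 2 ≤ γ₂) (hT : T ∈ Set.Icc (0 : ℝ) 1)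
    {f f' : ℕ → ℝ} {g g' : ℕ → ℕ → ℝ} (hf : ∀ k, f k ≤ f' k) (hg : ∀ k r, g k r ≤ g' k r) :
    couplingAvg γ₁ γ₂ T f g ≤ couplingAvg γ₁ γ₂ T f' g' := by
  have h₂ : (2 : ℝ) ≤ γ₂ := by exact_mod_cast hγ₂
  have hd : (0 : ℝ) ≤ (γ₁ : ℝ) * ((γ₂ : ℝ) - 1) := mul_nonneg (Nat.cast_nonneg _) (by linarith)
  exact add_le_add
    (mul_le_mul_of_nonneg_left (Finset.sum_le_sum fun k _ => hf k)
      (div_nonneg (by linarith [hT.2]) (Nat.cast_nonneg _)))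
    (mul_le_mul_of_nonneg_left
      (Finset.sum_le_sum fun k _ => Finset.sum_le_sum fun r _ => hg k r)
      (div_nonneg hT.1 hd))

theorem couplingAvg_const {γ₁ γ₂ : ℕ} (T : ℝ) (hγ₁ : 1 ≤ γ₁) (hγ₂ : 2 ≤ γ₂) (c : ℝ) :
    couplingAvg γ₁ γ₂ T (fun _ => c) (fun _ _ => c) = c := by
  have h₁ : (γ₁ : ℝ) ≠ 0 := by positivity
  have h₂ : (2 : ℝ) ≤ γ₂ := by exact_mod_cast hγ₂
  have h₃ : (γ₂ : ℝ) - 1 ≠ 0 := by linarith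
  have h₄ : ((γ₂ - 1 : ℕ) : ℝ) = (γ₂ : ℝ) - 1 := by
    rw [Nat.cast_sub (by omega), Nat.cast_one]
  simp only [couplingAvg, Finset.sum_const, Finset.card_range, Nat.card_Icc, nsmul_eq_mul,
    Nat.add_sub_cancel, h₄]
  field_simp
  ring

theorem couplingAvg_mem_Icc {γ₁ γ₂ : ℕ} {T : ℝ} (hγ₁ : 1 ≤ γ₁) (hγ₂ : 2 ≤ γ₂)
    (hT : T ∈ Set.Icc (0 : ℝ) 1) {f : ℕ → ℝ} {g : ℕ → ℕ → ℝ}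
    (hf : ∀ k, f k ∈ Set.Icc (0 : ℝ) 1) (hg : ∀ k r, g k r ∈ Set.Icc (0 : ℝ) 1) :
    couplingAvg γ₁ γ₂ T f g ∈ Set.Icc (0 : ℝ) 1 := by
  constructor
  · rw [← couplingAvg_const T hγ₁ hγ₂ 0]
    exact couplingAvg_mono hγ₂ hT (fun k => (hf k).1) fun k r => (hg k r).1
  · rw [← couplingAvg_const T hγ₁ hγ₂ 1]
    exact couplingAvg_mono hγ₂ hT (fun k => (hf k).2) fun k r => (hg k r).2

theorem chkY_eq (L₂ dr γ₁ γ₂ : ℕ) (T : ℝ) (z : ℤ × ZMod L₂ → ℝ) (p : ℤ × ZMod L₂) :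
    chkY L₂ dr γ₁ γ₂ T z p = 1 - (1 - couplingAvg γ₁ γ₂ T (fun k => z (p.1 - (k : ℤ), p.2))
      fun k r => z (p.1 - (k : ℤ), p.2 - (r : ZMod L₂))) ^ (dr - 1) := by
  rw [chkY, couplingAvg, sub_sub]

theorem updF_eq (L₂ dl dr γ₁ γ₂ : ℕ) (T ε : ℝ) (z : ℤ × ZMod L₂ → ℝ) (p : ℤ × ZMod L₂) :
    updF L₂ dl dr γ₁ γ₂ T ε z p =
      ε * couplingAvg γ₁ γ₂ T (fun k => chkY L₂ dr γ₁ γ₂ T z (p.1 + (k : ℤ), p.2))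
        (fun k r => chkY L₂ dr γ₁ γ₂ T z (p.1 + (k : ℤ), p.2 + (r : ZMod L₂))) ^ (dl - 1) :=
  rfl

theorem chkY_mem_Icc {L₂ γ₁ γ₂ : ℕ} {T : ℝ} (dr : ℕ) (hγ₁ : 1 ≤ γ₁) (hγ₂ : 2 ≤ γ₂)
    (hT : T ∈ Set.Icc (0 : ℝ) 1) {z : ℤ × ZMod L₂ → ℝ} (hz : ∀ p, z p ∈ Set.Icc (0 : ℝ) 1)
    (p : ℤ × ZMod L₂) : chkY L₂ dr γ₁ γ₂ T z p ∈ Set.Icc (0 : ℝ) 1 := by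
  rw [chkY_eq]
  have h := couplingAvg_mem_Icc hγ₁ hγ₂ hT (fun k : ℕ => hz (p.1 - (k : ℤ), p.2))
    fun k r : ℕ => hz (p.1 - (k : ℤ), p.2 - (r : ZMod L₂))
  exact ⟨sub_nonneg.2 (pow_le_one₀ (sub_nonneg.2 h.2) (sub_le_self _ h.1)),
    sub_le_self _ (pow_nonneg (sub_nonneg.2 h.2) _)⟩

theorem chkY_mono {L₂ γ₁ γ₂ : ℕ} {T : ℝ} (dr : ℕ) (hγ₁ : 1 ≤ γ₁) (hγ₂ : 2 ≤ γ₂)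
    (hT : T ∈ Set.Icc (0 : ℝ) 1) {z w : ℤ × ZMod L₂ → ℝ}
    (hw : ∀ p, w p ∈ Set.Icc (0 : ℝ) 1) (hzw : ∀ p, z p ≤ w p) (p : ℤ × ZMod L₂) :
    chkY L₂ dr γ₁ γ₂ T z p ≤ chkY L₂ dr γ₁ γ₂ T w p := by
  rw [chkY_eq, chkY_eq]
  have h := couplingAvg_mem_Icc hγ₁ hγ₂ hT (fun k : ℕ => hw (p.1 - (k : ℤ), p.2))
    fun k r : ℕ => hw (p.1 - (k : ℤ), p.2 - (r : ZMod L₂))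
  exact sub_le_sub_left (pow_le_pow_left₀ (sub_nonneg.2 h.2)
    (sub_le_sub_left (couplingAvg_mono hγ₂ hT (fun _ => hzw _) fun _ _ => hzw _) _) _) _

theorem updF_mem_Icc {L₂ γ₁ γ₂ : ℕ} {T ε : ℝ} (dl dr : ℕ) (hγ₁ : 1 ≤ γ₁) (hγ₂ : 2 ≤ γ₂)
    (hT : T ∈ Set.Icc (0 : ℝ) 1) (hε : ε ∈ Set.Icc (0 : ℝ) 1) {z : ℤ × ZMod L₂ → ℝ}
    (hz : ∀ p, z p ∈ Set.Icc (0 : ℝ) 1) (p : ℤ × ZMod L₂) :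
    updF L₂ dl dr γ₁ γ₂ T ε z p ∈ Set.Icc (0 : ℝ) 1 := by
  rw [updF_eq]
  have h := couplingAvg_mem_Icc hγ₁ hγ₂ hT
    (fun k : ℕ => chkY_mem_Icc dr hγ₁ hγ₂ hT hz (p.1 + (k : ℤ), p.2))
    fun k r : ℕ => chkY_mem_Icc dr hγ₁ hγ₂ hT hz (p.1 + (k : ℤ), p.2 + (r : ZMod L₂))
  exact ⟨mul_nonneg hε.1 (pow_nonneg h.1 _),
    mul_le_one₀ hε.2 (pow_nonneg h.1 _) (pow_le_one₀ h.1 h.2)⟩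

theorem updF_mono {L₂ γ₁ γ₂ : ℕ} {T ε : ℝ} (dl dr : ℕ) (hγ₁ : 1 ≤ γ₁) (hγ₂ : 2 ≤ γ₂)
    (hT : T ∈ Set.Icc (0 : ℝ) 1) (hε : 0 ≤ ε) {z w : ℤ × ZMod L₂ → ℝ}
    (hz : ∀ p, z p ∈ Set.Icc (0 : ℝ) 1) (hw : ∀ p, w p ∈ Set.Icc (0 : ℝ) 1)
    (hzw : ∀ p, z p ≤ w p) (p : ℤ × ZMod L₂) :
    updF L₂ dl dr γ₁ γ₂ T ε z p ≤ updF L₂ dl dr γ₁ γ₂ T ε w p := by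
  rw [updF_eq, updF_eq]
  have h := couplingAvg_mem_Icc hγ₁ hγ₂ hT
    (fun k : ℕ => chkY_mem_Icc dr hγ₁ hγ₂ hT hz (p.1 + (k : ℤ), p.2))
    fun k r : ℕ => chkY_mem_Icc dr hγ₁ hγ₂ hT hz (p.1 + (k : ℤ), p.2 + (r : ZMod L₂))
  exact mul_le_mul_of_nonneg_left (pow_le_pow_left₀ h.1
    (couplingAvg_mono hγ₂ hT (fun _ => chkY_mono dr hγ₁ hγ₂ hT hw hzw _)
      fun _ _ => chkY_mono dr hγ₁ hγ₂ hT hw hzw _) _) hε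

theorem xMD_mem_Icc {γ₁ γ₂ : ℕ} {T ε : ℝ} (L₁ L₂ dl dr : ℕ) (hγ₁ : 1 ≤ γ₁) (hγ₂ : 2 ≤ γ₂)
    (hT : T ∈ Set.Icc (0 : ℝ) 1) (hε : ε ∈ Set.Icc (0 : ℝ) 1) (l : ℕ) (p : ℤ × ZMod L₂) :
    xMD L₁ L₂ dl dr γ₁ γ₂ T ε l p ∈ Set.Icc (0 : ℝ) 1 := by
  induction l generalizing p with
  | zero =>
    rw [xMD]
    beta_reduce
    split_ifs <;> simp
  | succ l ih =>
    rw [xMD]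
    beta_reduce
    split_ifs
    · exact updF_mem_Icc dl dr hγ₁ hγ₂ hT hε ih p
    · simp

theorem xMD_succ_le {γ₁ γ₂ : ℕ} {T ε : ℝ} (L₁ L₂ dl dr : ℕ) (hγ₁ : 1 ≤ γ₁) (hγ₂ : 2 ≤ γ₂)
    (hT : T ∈ Set.Icc (0 : ℝ) 1) (hε : ε ∈ Set.Icc (0 : ℝ) 1) (l : ℕ) (p : ℤ × ZMod L₂) :
    xMD L₁ L₂ dl dr γ₁ γ₂ T ε (l + 1) p ≤ xMD L₁ L₂ dl dr γ₁ γ₂ T ε l p := by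
  have hmem := xMD_mem_Icc L₁ L₂ dl dr hγ₁ hγ₂ hT hε
  induction l generalizing p with
  | zero =>
    rw [xMD, xMD]
    beta_reduce
    split_ifs
    · exact (updF_mem_Icc dl dr hγ₁ hγ₂ hT hε (hmem 0) p).2
    · exact le_rfl
  | succ l ih =>
    rw [xMD, xMD]
    beta_reduce
    split_ifs
    · exact updF_mono dl dr hγ₁ hγ₂ hT hε.1 (hmem (l + 1)) (hmem l) ih p
    · exact le_rfl

/-- the MD DE sequence is entrywise nonincreasing in the iteration
index, and consequently each entry converges to a limit in `[0,1]`. -/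
theorem stmt3 (dl dr L₁ L₂ γ₁ γ₂ : ℕ) (T ε : ℝ)
    (hdl : 2 ≤ dl) (hdr : 2 ≤ dr) (hL₁ : 1 ≤ L₁) (hL₂ : 2 ≤ L₂)
    (hγ₁ : 1 ≤ γ₁) (hγ₁L : γ₁ ≤ L₁) (hγ₂ : 2 ≤ γ₂) (hγ₂L : γ₂ ≤ L₂)
    (hT : T ∈ Set.Icc (0 : ℝ) 1) (hε : ε ∈ Set.Icc (0 : ℝ) 1) :
    (∀ (l : ℕ) (p : ℤ × ZMod L₂),
      xMD L₁ L₂ dl dr γ₁ γ₂ T ε (l + 1) p ≤ xMD L₁ L₂ dl dr γ₁ γ₂ T ε l p) ∧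
    (∀ p : ℤ × ZMod L₂, ∃ a ∈ Set.Icc (0 : ℝ) 1,
      Filter.Tendsto (fun l => xMD L₁ L₂ dl dr γ₁ γ₂ T ε l p) Filter.atTop (nhds a)) := by
  have hmem := xMD_mem_Icc L₁ L₂ dl dr hγ₁ hγ₂ hT hε
  have hle := xMD_succ_le L₁ L₂ dl dr hγ₁ hγ₂ hT hε
  refine ⟨hle, fun p => ?_⟩
  have hlim := tendsto_atTop_ciInf (antitone_nat_of_succ_le fun l => hle l p)
    ⟨0, Set.forall_mem_range.2 fun l => (hmem l p).1⟩
  exact ⟨_, isClosed_Icc.mem_of_tendsto hlim (Filter.Eventually.of_forall fun l => hmem l p), hlim⟩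
end
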